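/- Let Ω ⊂ ℝ^n be a smooth domain and suppose v ∈ H²(Ω) satisfies the measure-valued equation ∫_Ω Δv·Δφ dx = ∫_Ω φ dμ for all φ ∈ C₀^∞(Ω), where μ is a signed Radon measure on Ω. Then v ∈ W^{3,q}_loc(Ω) for every q ∈ (1, n/(n−1)). -/

import Mathlib

open MeasureTheory Metric Set Filter Topology
open scoped ENNReal

noncomputable section

/-- `n`-dimensional Euclidean space. -/
abbrev RH (n : ℕ) := EuclideanSpace ℝ (Fin n)

variable {n : ℕ}

/-- Smooth compactly supported test functions with support contained in `Ω`. -/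
def IsTestFun (Ω : Set (RH n)) (φ : RH n → ℝ) : Prop :=
  ContDiff ℝ (⊤ : ℕ∞) φ ∧ HasCompactSupport φ ∧ tsupport φ ⊆ Ω

/-- Classical partial derivative in the `i`-th coordinate direction. -/
def cpderiv (i : Fin n) (φ : RH n → ℝ) : RH n → ℝ :=
  fun x => fderiv ℝ φ x (EuclideanSpace.single i 1)

/-- Classical Laplacian of a (smooth) function. -/
def cLaplacian (φ : RH n → ℝ) : RH n → ℝ :=
  fun x => ∑ i, cpderiv i (cpderiv i φ) x

/-- `g` is the weak `i`-th partial derivative of `u` on `Ω`. -/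
def IsWeakPartial (Ω : Set (RH n)) (i : Fin n) (u g : RH n → ℝ) : Prop :=
  ∀ φ : RH n → ℝ, IsTestFun Ω φ →
    ∫ x in Ω, u x * cpderiv i φ x = - ∫ x in Ω, g x * φ x

/-- `g` is a weak Laplacian of `u` on `Ω`. -/
def IsWeakLaplacian (Ω : Set (RH n)) (u g : RH n → ℝ) : Prop :=
  ∀ φ : RH n → ℝ, IsTestFun Ω φ →
    ∫ x in Ω, u x * cLaplacian φ x = ∫ x in Ω, g x * φ x

/-- `u ∈ H²(Ω)` with weak gradient `g` and weak Hessian `h`. -/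
def IsH2With (Ω : Set (RH n)) (u : RH n → ℝ) (g : Fin n → RH n → ℝ)
    (h : Fin n → Fin n → RH n → ℝ) : Prop :=
  MemLp u 2 (volume.restrict Ω) ∧
  (∀ i, IsWeakPartial Ω i u (g i) ∧ MemLp (g i) 2 (volume.restrict Ω)) ∧
  (∀ i j, IsWeakPartial Ω j (g i) (h i j) ∧ MemLp (h i j) 2 (volume.restrict Ω))

/-- `u ∈ H²(Ω)`. -/
def MemH2 (Ω : Set (RH n)) (u : RH n → ℝ) : Prop :=
  ∃ g h, IsH2With Ω u g h

/-- `u ∈ H₀²(Ω)`: `u ∈ H²(Ω)` and `u` is approximable in the `H²`-norm by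
test functions supported in `Ω`. -/
def MemH20 (Ω : Set (RH n)) (u : RH n → ℝ) : Prop :=
  ∃ g h, IsH2With Ω u g h ∧
    ∃ φ : ℕ → RH n → ℝ, (∀ k, IsTestFun Ω (φ k)) ∧
      Tendsto (fun k => eLpNorm (fun x => u x - φ k x) 2 (volume.restrict Ω)) atTop (𝓝 0) ∧
      (∀ i, Tendsto (fun k => eLpNorm (fun x => g i x - cpderiv i (φ k) x) 2
        (volume.restrict Ω)) atTop (𝓝 0)) ∧
      (∀ i j, Tendsto (fun k => eLpNorm (fun x => h i j x - cpderiv j (cpderiv i (φ k)) x) 2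
        (volume.restrict Ω)) atTop (𝓝 0))

/-- `u ∈ H²_loc(ℝⁿ)`. -/
def MemH2loc (u : RH n → ℝ) : Prop :=
  ∀ Ω : Set (RH n), IsOpen Ω → Bornology.IsBounded Ω → MemH2 Ω u

/-- The two-sided biharmonic Alt–Caffarelli functional
`F(u,Ω) = ∫_Ω (Δu)² dx + |{x ∈ Ω : u x ≠ 0}|`, where the (weak) Laplacian
`Δu = lapu` is given explicitly. -/
def ACF (Ω : Set (RH n)) (lapu u : RH n → ℝ) : ℝ :=
  (∫ x in Ω, (lapu x) ^ 2) + (volume {x ∈ Ω | u x ≠ 0}).toReal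

/-- `u` is a global minimizer of the two-sided biharmonic Alt–Caffarelli functional. -/
def IsGlobalMinimizer (u : RH n → ℝ) : Prop :=
  MemH2loc u ∧
  ∀ Ω : Set (RH n), IsOpen Ω → Bornology.IsBounded Ω →
    ∀ v : RH n → ℝ, MemH2 Ω v → MemH20 Ω (fun x => v x - u x) →
      ∀ lapu lapv : RH n → ℝ, IsWeakLaplacian Ω u lapu → IsWeakLaplacian Ω v lapv →
        ACF Ω lapu u ≤ ACF Ω lapv v


/-- `u ∈ W^{3,q}(U)`: `u` and its weak derivatives up to order three lie in
`L^q(U)`. -/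
def MemW3q {n : ℕ} (U : Set (RH n)) (q : ℝ≥0∞) (u : RH n → ℝ) : Prop :=
  MemLp u q (volume.restrict U) ∧
  ∃ g : Fin n → RH n → ℝ,
    (∀ i, IsWeakPartial U i u (g i) ∧ MemLp (g i) q (volume.restrict U)) ∧
    ∃ h : Fin n → Fin n → RH n → ℝ,
      (∀ i j, IsWeakPartial U j (g i) (h i j) ∧ MemLp (h i j) q (volume.restrict U)) ∧
      ∃ k : Fin n → Fin n → Fin n → RH n → ℝ,
        ∀ i j l, IsWeakPartial U l (h i j) (k i j l) ∧ MemLp (k i j l) q (volume.restrict U)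

/-- `u ∈ W^{3,q}_loc(Ω)`. -/
def MemW3qLoc {n : ℕ} (Ω : Set (RH n)) (q : ℝ≥0∞) (u : RH n → ℝ) : Prop :=
  ∀ U : Set (RH n), IsOpen U → IsCompact (closure U) → closure U ⊆ Ω → MemW3q U q u

/-- `Ω` is a smooth domain: it is open and its boundary is locally the regular zero
level set of a smooth function. -/
def IsSmoothDomain {n : ℕ} (Ω : Set (RH n)) : Prop :=
  IsOpen Ω ∧ ∀ x ∈ frontier Ω, ∃ U : Set (RH n), IsOpen U ∧ x ∈ U ∧
    ∃ f : RH n → ℝ, ContDiffOn ℝ (⊤ : ℕ∞) f U ∧ frontier Ω ∩ U = {y ∈ U | f y = 0} ∧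
      ∀ y ∈ frontier Ω ∩ U, fderivWithin ℝ f U y ≠ 0

theorem ContDiff.cpderiv {φ : RH n → ℝ} (hφ : ContDiff ℝ (⊤ : ℕ∞) φ) (i : Fin n) :
    ContDiff ℝ (⊤ : ℕ∞) (cpderiv i φ) :=
  (contDiff_infty_iff_fderiv.1 hφ).2.clm_apply contDiff_const

theorem tsupport_cpderiv_subset (φ : RH n → ℝ) (i : Fin n) :
    tsupport (cpderiv i φ) ⊆ tsupport φ :=
  tsupport_fderiv_apply_subset ℝ _

theorem HasCompactSupport.cpderiv {φ : RH n → ℝ} (hφ : HasCompactSupport φ) (i : Fin n) :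
    HasCompactSupport (cpderiv i φ) :=
  hφ.of_isClosed_subset (isClosed_tsupport _) (tsupport_cpderiv_subset φ i)

theorem ContDiff.cLaplacian {φ : RH n → ℝ} (hφ : ContDiff ℝ (⊤ : ℕ∞) φ) :
    ContDiff ℝ (⊤ : ℕ∞) (cLaplacian φ) :=
  ContDiff.sum fun i _ => (hφ.cpderiv i).cpderiv i

theorem tsupport_cLaplacian_subset (φ : RH n → ℝ) : tsupport (cLaplacian φ) ⊆ tsupport φ := by
  refine closure_minimal (fun x hx => ?_) (isClosed_tsupport _)
  obtain ⟨i, -, hi⟩ := Finset.exists_ne_zero_of_sum_ne_zero (Function.mem_support.1 hx)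
  exact tsupport_cpderiv_subset _ i (tsupport_cpderiv_subset _ i (subset_tsupport _ hi))

theorem HasCompactSupport.cLaplacian {φ : RH n → ℝ} (hφ : HasCompactSupport φ) :
    HasCompactSupport (cLaplacian φ) :=
  hφ.of_isClosed_subset (isClosed_tsupport _) (tsupport_cLaplacian_subset φ)

theorem IsTestFun.cpderiv {Ω : Set (RH n)} {φ : RH n → ℝ} (hφ : IsTestFun Ω φ) (i : Fin n) :
    IsTestFun Ω (cpderiv i φ) :=
  ⟨hφ.1.cpderiv i, hφ.2.1.cpderiv i, (tsupport_cpderiv_subset φ i).trans hφ.2.2⟩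

theorem IsTestFun.cLaplacian {Ω : Set (RH n)} {φ : RH n → ℝ} (hφ : IsTestFun Ω φ) :
    IsTestFun Ω (cLaplacian φ) :=
  ⟨hφ.1.cLaplacian, hφ.2.1.cLaplacian, (tsupport_cLaplacian_subset φ).trans hφ.2.2⟩

theorem IsTestFun.mono {U Ω : Set (RH n)} {φ : RH n → ℝ} (hφ : IsTestFun U φ) (h : U ⊆ Ω) :
    IsTestFun Ω φ :=
  ⟨hφ.1, hφ.2.1, hφ.2.2.trans h⟩

theorem IsTestFun.eq_zero_of_notMem {U : Set (RH n)} {φ : RH n → ℝ} (hφ : IsTestFun U φ)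
    {x : RH n} (hx : x ∉ U) : φ x = 0 :=
  image_eq_zero_of_notMem_tsupport fun h => hx (hφ.2.2 h)

theorem IsTestFun.setIntegral_mul_eq {U : Set (RH n)} {φ : RH n → ℝ} (hφ : IsTestFun U φ)
    (f : RH n → ℝ) : ∫ x in U, f x * φ x = ∫ x, f x * φ x :=
  setIntegral_eq_integral_of_forall_compl_eq_zero fun x hx => by
    rw [hφ.eq_zero_of_notMem hx, mul_zero]

theorem IsWeakPartial.mono {U Ω : Set (RH n)} {i : Fin n} {u g : RH n → ℝ}
    (h : IsWeakPartial Ω i u g) (hU : U ⊆ Ω) : IsWeakPartial U i u g := by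
  intro φ hφ
  have := h φ (hφ.mono hU)
  rwa [((hφ.mono hU).cpderiv i).setIntegral_mul_eq, (hφ.mono hU).setIntegral_mul_eq,
    ← (hφ.cpderiv i).setIntegral_mul_eq, ← hφ.setIntegral_mul_eq] at this

/-- Integration by parts for an average over dilated translates. -/
theorem mul_integral_mul_cpderiv_sub_smul {θ w : RH n → ℝ} (hθ : ContDiff ℝ (⊤ : ℕ∞) θ)
    (hθc : HasCompactSupport θ) (hw : ContDiff ℝ (⊤ : ℕ∞) w) (i : Fin n) (x : RH n) (t : ℝ) :
    t * ∫ z, θ z * cpderiv i w (x - t • z) = ∫ z, cpderiv i θ z * w (x - t • z) := by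
  have hg : ContDiff ℝ (⊤ : ℕ∞) (fun z : RH n => w (x - t • z)) := by fun_prop
  have hgd : ∀ z, fderiv ℝ (fun z : RH n => w (x - t • z)) z (EuclideanSpace.single i 1)
      = - (t * cpderiv i w (x - t • z)) := by
    intro z
    have h1 : HasFDerivAt (fun z : RH n => x - t • z) (-(t • ContinuousLinearMap.id ℝ (RH n))) z :=
      ((hasFDerivAt_id z).const_smul t).const_sub x
    have h2 := ((hw.differentiable (by simp)) (x - t • z)).hasFDerivAt.comp z h1
    have h3 := h2.fderiv
    simp only [Function.comp_def] at h3
    rw [h3]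
    simp [cpderiv]
  have key := integral_mul_fderiv_eq_neg_fderiv_mul_of_integrable (μ := (volume : Measure (RH n)))
    (f := θ) (g := fun z : RH n => w (x - t • z)) (v := EuclideanSpace.single i 1)
    ((((hθ.cpderiv i).continuous.mul hg.continuous).integrable_of_hasCompactSupport
      ((hθc.cpderiv i).mul_right)))
    (by
      simp_rw [hgd]
      refine Continuous.integrable_of_hasCompactSupport ?_ hθc.mul_right
      have := (hw.cpderiv i).continuous
      have := hθ.continuous
      fun_prop)
    ((hθ.continuous.mul hg.continuous).integrable_of_hasCompactSupport hθc.mul_right)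
    (fun y _ => (hθ.differentiable (by simp)) y) (fun y _ => (hg.differentiable (by simp)) y)
  simp_rw [hgd] at key
  rw [← integral_const_mul]
  have h4 : ∫ z, t * (θ z * cpderiv i w (x - t • z))
      = - ∫ z, θ z * -(t * cpderiv i w (x - t • z)) := by
    rw [← integral_neg]
    congr 1; ext z; ring
  rw [h4, key, neg_neg]
  rfl

theorem pow_three_mul_integral_mul_cpderiv_sub_smul {θ w : RH n → ℝ}
    (hθ : ContDiff ℝ (⊤ : ℕ∞) θ) (hθc : HasCompactSupport θ) (hw : ContDiff ℝ (⊤ : ℕ∞) w)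
    (i j l : Fin n) (x : RH n) (t : ℝ) :
    t ^ 3 * ∫ z, θ z * cpderiv i (cpderiv j (cpderiv l w)) (x - t • z)
      = ∫ z, cpderiv l (cpderiv j (cpderiv i θ)) z * w (x - t • z) := by
  rw [← mul_integral_mul_cpderiv_sub_smul ((hθ.cpderiv i).cpderiv j) ((hθc.cpderiv i).cpderiv j) hw,
    ← mul_integral_mul_cpderiv_sub_smul (hθ.cpderiv i) (hθc.cpderiv i) (hw.cpderiv l),
    ← mul_integral_mul_cpderiv_sub_smul hθ hθc ((hw.cpderiv l).cpderiv j)]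
  ring

theorem integrable_mul_comp_sub_smul {θ w : RH n → ℝ} (hθ : Continuous θ)
    (hθc : HasCompactSupport θ) (hw : Continuous w) (x : RH n) (t : ℝ) :
    Integrable (fun z => θ z * w (x - t • z)) :=
  Continuous.integrable_of_hasCompactSupport (by fun_prop) hθc.mul_right

theorem sq_mul_integral_mul_cLaplacian_sub_smul {θ w : RH n → ℝ}
    (hθ : ContDiff ℝ (⊤ : ℕ∞) θ) (hθc : HasCompactSupport θ) (hw : ContDiff ℝ (⊤ : ℕ∞) w)
    (x : RH n) (t : ℝ) :
    t ^ 2 * ∫ z, θ z * cLaplacian w (x - t • z) = ∫ z, cLaplacian θ z * w (x - t • z) := by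
  simp only [cLaplacian, Finset.mul_sum, Finset.sum_mul]
  rw [integral_finsetSum _ fun i _ => integrable_mul_comp_sub_smul hθ.continuous hθc
      ((hw.cpderiv i).cpderiv i).continuous x t,
    integral_finsetSum _ fun i _ => integrable_mul_comp_sub_smul
      ((hθ.cpderiv i).cpderiv i).continuous ((hθc.cpderiv i).cpderiv i) hw.continuous x t,
    Finset.mul_sum]
  refine Finset.sum_congr rfl fun i _ => ?_
  rw [← mul_integral_mul_cpderiv_sub_smul (hθ.cpderiv i) (hθc.cpderiv i) hw,
    ← mul_integral_mul_cpderiv_sub_smul hθ hθc (hw.cpderiv i)]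
  ring

theorem pow_three_mul_integral_mul_cLaplacian_cLaplacian_sub_smul {θ w : RH n → ℝ}
    (hθ : ContDiff ℝ (⊤ : ℕ∞) θ) (hθc : HasCompactSupport θ) (hw : ContDiff ℝ (⊤ : ℕ∞) w)
    (x : RH n) (t : ℝ) :
    t ^ 3 * ∫ z, θ z * cLaplacian (cLaplacian w) (x - t • z)
      = ∫ z, ∑ i, cpderiv i (cLaplacian θ) z * cpderiv i w (x - t • z) := by
  rw [pow_succ', mul_assoc, sq_mul_integral_mul_cLaplacian_sub_smul hθ hθc hw.cLaplacian]
  rw [integral_finsetSum _ fun i _ => integrable_mul_comp_sub_smul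
      (hθ.cLaplacian.cpderiv i).continuous (hθc.cLaplacian.cpderiv i)
      (hw.cpderiv i).continuous x t]
  simp_rw [← mul_integral_mul_cpderiv_sub_smul hθ.cLaplacian hθc.cLaplacian (hw.cpderiv _)]
  rw [← Finset.mul_sum, ← integral_finsetSum _ fun i _ => integrable_mul_comp_sub_smul
      hθ.cLaplacian.continuous hθc.cLaplacian ((hw.cpderiv i).cpderiv i).continuous x t]
  simp only [_root_.cLaplacian, Finset.mul_sum]

theorem integral_cpderiv_eq_zero {θ : RH n → ℝ} (hθ : ContDiff ℝ (⊤ : ℕ∞) θ)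
    (hθc : HasCompactSupport θ) (i : Fin n) : ∫ z, cpderiv i θ z = 0 := by
  simpa using (mul_integral_mul_cpderiv_sub_smul hθ hθc
    (contDiff_const (c := (1 : ℝ))) i 0 0).symm

theorem cpderiv_mul {u w : RH n → ℝ} (hu : ContDiff ℝ (⊤ : ℕ∞) u) (hw : ContDiff ℝ (⊤ : ℕ∞) w)
    (i : Fin n) (z : RH n) :
    cpderiv i (fun z => u z * w z) z = u z * cpderiv i w z + w z * cpderiv i u z := by
  have h := ((hu.differentiable (by simp) z).hasFDerivAt.mul
    (hw.differentiable (by simp) z).hasFDerivAt).fderiv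
  simp only [cpderiv]
  change fderiv ℝ (u * w) z _ = _
  rw [h]
  simp

theorem cpderiv_apply_self (i : Fin n) (z : RH n) : cpderiv i (fun z : RH n => z i) z = 1 := by
  have h : HasFDerivAt (fun z : RH n => z i) (EuclideanSpace.proj (𝕜 := ℝ) i) z :=
    (EuclideanSpace.proj (𝕜 := ℝ) i).hasFDerivAt
  simp [cpderiv, h.fderiv]

theorem cpderiv_comp_norm_sq {F : ℝ → ℝ} (hF : ContDiff ℝ (⊤ : ℕ∞) F) (i : Fin n) :
    cpderiv i (fun z : RH n => F (‖z‖ ^ 2)) = fun z => z i * (2 * deriv F (‖z‖ ^ 2)) := by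
  ext z
  have h1 : HasFDerivAt (fun z : RH n => ‖z‖ ^ 2) (2 • innerSL ℝ z) z :=
    (hasStrictFDerivAt_norm_sq z).hasFDerivAt
  have h2 := ((hF.differentiable (by simp)) (‖z‖ ^ 2)).hasDerivAt.comp_hasFDerivAt z h1
  have h3 := h2.fderiv
  simp only [Function.comp_def] at h3
  simp only [cpderiv]
  rw [h3]
  simp [EuclideanSpace.inner_single_right]
  ring

theorem contDiff_coord (i : Fin n) : ContDiff ℝ (⊤ : ℕ∞) (fun z : RH n => z i) :=
  (EuclideanSpace.proj (𝕜 := ℝ) i).contDiff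

theorem contDiff_comp_norm_sq {F : ℝ → ℝ} (hF : ContDiff ℝ (⊤ : ℕ∞) F) :
    ContDiff ℝ (⊤ : ℕ∞) (fun z : RH n => F (‖z‖ ^ 2)) :=
  hF.comp (contDiff_norm_sq ℝ)

theorem cpderiv_coord_mul_comp_norm_sq {F : ℝ → ℝ} (hF : ContDiff ℝ (⊤ : ℕ∞) F) (i : Fin n)
    (z : RH n) :
    cpderiv i (fun z : RH n => z i * F (‖z‖ ^ 2)) z
      = F (‖z‖ ^ 2) + 2 * (z i) ^ 2 * deriv F (‖z‖ ^ 2) := by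
  rw [cpderiv_mul (contDiff_coord i) (contDiff_comp_norm_sq hF), cpderiv_comp_norm_sq hF,
    cpderiv_apply_self]
  ring

theorem sum_cpderiv_coord_mul_comp_norm_sq {F : ℝ → ℝ} (hF : ContDiff ℝ (⊤ : ℕ∞) F)
    (z : RH n) :
    ∑ i, cpderiv i (fun z : RH n => z i * F (‖z‖ ^ 2)) z
      = n * F (‖z‖ ^ 2) + 2 * ‖z‖ ^ 2 * deriv F (‖z‖ ^ 2) := by
  simp_rw [cpderiv_coord_mul_comp_norm_sq hF]
  rw [Finset.sum_add_distrib, ← Finset.sum_mul, ← Finset.mul_sum, ← EuclideanSpace.real_norm_sq_eq]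
  simp

theorem cLaplacian_comp_norm_sq {F : ℝ → ℝ} (hF : ContDiff ℝ (⊤ : ℕ∞) F) :
    cLaplacian (fun z : RH n => F (‖z‖ ^ 2))
      = fun z => n * (2 * deriv F (‖z‖ ^ 2)) + 2 * ‖z‖ ^ 2 * (2 * deriv (deriv F) (‖z‖ ^ 2)) := by
  ext z
  simp only [cLaplacian]
  simp_rw [cpderiv_comp_norm_sq hF]
  have hF' : ContDiff ℝ (⊤ : ℕ∞) (deriv F) := (contDiff_infty_iff_deriv.1 hF).2
  have h := sum_cpderiv_coord_mul_comp_norm_sq (n := n) (F := fun s => 2 * deriv F s)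
    (by fun_prop) z
  rw [h, deriv_const_mul _ (hF'.differentiable (by simp) _)]

/-- The radial profile `s ↦ exp (-1 / (1/4 - s))` on `s < 1/4`, and its second derivative. -/
theorem exists_convex_profile : ∃ f : ℝ → ℝ, ContDiff ℝ (⊤ : ℕ∞) f ∧ (∀ s, 1 / 4 ≤ s → f s = 0) ∧
    (∀ s, 0 ≤ s → 0 ≤ deriv (deriv f) s) ∧ deriv (deriv f) 0 ≠ 0 := by
  have h1 : ∀ y, HasDerivAt expNegInvGlue ((y⁻¹) ^ 2 * expNegInvGlue y) y := fun y => by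
    simpa using expNegInvGlue.hasDerivAt_polynomial_eval_inv_mul 1 y
  have h2 : ∀ y, HasDerivAt (fun y => (y⁻¹) ^ 2 * expNegInvGlue y)
      ((y⁻¹) ^ 2 * ((y⁻¹) ^ 2 - 2 * y⁻¹) * expNegInvGlue y) y := fun y => by
    have := expNegInvGlue.hasDerivAt_polynomial_eval_inv_mul (Polynomial.X * Polynomial.X) y
    simp only [Polynomial.eval_mul, Polynomial.eval_X, Polynomial.derivative_mul,
      Polynomial.derivative_X, Polynomial.eval_sub, Polynomial.eval_add, Polynomial.eval_pow,
      Polynomial.eval_one] at this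
    convert this using 1 <;> ring_nf
  have hs : ∀ s : ℝ, HasDerivAt (fun s : ℝ => 1 / 4 - s) (-1) s := fun s => by
    exact (hasDerivAt_id s).const_sub (1 / 4)
  have d1 : deriv (fun s : ℝ => expNegInvGlue (1 / 4 - s))
      = fun s => -(((1 / 4 - s)⁻¹) ^ 2 * expNegInvGlue (1 / 4 - s)) := by
    ext s
    have := ((h1 (1 / 4 - s)).comp s (hs s)).deriv
    simp only [Function.comp_def] at this
    rw [this]; ring
  have d2 : deriv (deriv (fun s : ℝ => expNegInvGlue (1 / 4 - s))) = fun s : ℝ =>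
      ((1 / 4 - s)⁻¹) ^ 2 * (((1 / 4 - s)⁻¹) ^ 2 - 2 * (1 / 4 - s)⁻¹)
        * expNegInvGlue (1 / 4 - s) := by
    rw [d1]
    ext s
    have := ((h2 (1 / 4 - s)).comp s (hs s)).neg.deriv
    simp only [Function.comp_def, Pi.neg_def] at this
    rw [this]; ring
  refine ⟨fun s => expNegInvGlue (1 / 4 - s), expNegInvGlue.contDiff.comp (by fun_prop),
    fun s hs => expNegInvGlue.zero_of_nonpos (by linarith), fun s h0 => ?_, ?_⟩
  · rw [d2]
    rcases le_or_gt (1 / 4) s with h | h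
    · simp only [expNegInvGlue.zero_of_nonpos (show 1 / 4 - s ≤ 0 by linarith), mul_zero, le_refl]
    · have hy : 4 ≤ (1 / 4 - s)⁻¹ := by
        rw [le_inv_comm₀ (by norm_num) (by linarith)]; linarith
      have := expNegInvGlue.nonneg (1 / 4 - s)
      have h3 : 0 ≤ ((1 / 4 - s)⁻¹) ^ 2 - 2 * (1 / 4 - s)⁻¹ := by nlinarith
      positivity
  · rw [d2]
    have := expNegInvGlue.pos_of_pos (show (0 : ℝ) < 1 / 4 - 0 by norm_num)
    have h3 : ((1 / 4 - (0 : ℝ))⁻¹) ^ 2 * (((1 / 4 - (0 : ℝ))⁻¹) ^ 2 - 2 * (1 / 4 - (0 : ℝ))⁻¹) = 128 := by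
      norm_num
    simp only [h3]
    positivity

theorem hasCompactSupport_of_eq_zero_of_one_le_norm {f : RH n → ℝ} (h : ∀ z, 1 ≤ ‖z‖ → f z = 0) :
    HasCompactSupport f :=
  HasCompactSupport.intro (isCompact_closedBall (0 : RH n) 1) fun z hz =>
    h z (by simpa using (not_le.1 (mt mem_closedBall_zero_iff.2 hz)).le)

/-- A radial bump `θ` whose bi-Laplacian is the divergence of `z ↦ σ z • z` for a
compactly supported `σ` of positive mass. -/
theorem exists_cLaplacian_gradient_profile (n : ℕ) : ∃ θ σ : RH n → ℝ,
    ContDiff ℝ (⊤ : ℕ∞) θ ∧ ContDiff ℝ (⊤ : ℕ∞) σ ∧ HasCompactSupport θ ∧ HasCompactSupport σ ∧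
    (∀ z, 1 < ‖z‖ → θ z = 0) ∧ (∀ z, 1 < ‖z‖ → σ z = 0) ∧
    (∀ i z, cpderiv i (cLaplacian θ) z = z i * σ z) ∧ 0 < ∫ z, σ z := by
  obtain ⟨f, hf, hf0, hf2, hf20⟩ := exists_convex_profile
  have hf' : ContDiff ℝ (⊤ : ℕ∞) (deriv f) := (contDiff_infty_iff_deriv.1 hf).2
  have hf'' : ContDiff ℝ (⊤ : ℕ∞) (deriv (deriv f)) := (contDiff_infty_iff_deriv.1 hf').2
  have hf''' : ContDiff ℝ (⊤ : ℕ∞) (deriv (deriv (deriv f))) := (contDiff_infty_iff_deriv.1 hf'').2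
  have dzero : ∀ F : ℝ → ℝ, (∀ s, 1 / 4 < s → F s = 0) → ∀ s, 1 / 4 < s → deriv F s = 0 := by
    intro F hF s hs
    have : F =ᶠ[𝓝 s] fun _ => 0 := by
      filter_upwards [lt_mem_nhds hs] with y hy using hF y hy
    rw [this.deriv_eq, deriv_const]
  have z0 : ∀ s, 1 / 4 < s → f s = 0 := fun s hs => hf0 s hs.le
  have z1 := dzero f z0
  have z2 := dzero _ z1
  have z3 := dzero _ z2
  have hq : ∀ z : RH n, 1 ≤ ‖z‖ → 1 / 4 < ‖z‖ ^ 2 := fun z hz => by nlinarith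
  set g : ℝ → ℝ := fun s => n * (2 * deriv f s) + 2 * s * (2 * deriv (deriv f) s) with hg
  have hgc : ContDiff ℝ (⊤ : ℕ∞) g := by fun_prop
  have hgd : ∀ s, deriv g s = (2 * n + 4) * deriv (deriv f) s
      + 4 * s * deriv (deriv (deriv f)) s := by
    intro s
    have e1 := (hf'.differentiable (by simp) s).hasDerivAt
    have e2 := (hf''.differentiable (by simp) s).hasDerivAt
    have := (((e1.const_mul 2).const_mul (n : ℝ)).add
      (((hasDerivAt_id s).const_mul 2).mul (e2.const_mul 2))).deriv
    simp only [id] at this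
    refine Eq.trans ?_ (this.trans (by ring))
    rfl
  have hσ : ∀ z : RH n, 2 * deriv g (‖z‖ ^ 2) = 8 * deriv (deriv f) (‖z‖ ^ 2)
      + 4 * ∑ i, cpderiv i (fun z : RH n => z i * deriv (deriv f) (‖z‖ ^ 2)) z := by
    intro z
    rw [sum_cpderiv_coord_mul_comp_norm_sq hf'', hgd]
    ring
  have hc2 : HasCompactSupport fun z : RH n => deriv (deriv f) (‖z‖ ^ 2) :=
    hasCompactSupport_of_eq_zero_of_one_le_norm fun z hz => z2 _ (hq z hz)
  have hc2' : ContDiff ℝ (⊤ : ℕ∞) fun z : RH n => deriv (deriv f) (‖z‖ ^ 2) :=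
    contDiff_comp_norm_sq hf''
  have hmulc : ∀ i : Fin n, ContDiff ℝ (⊤ : ℕ∞) fun z : RH n => z i * deriv (deriv f) (‖z‖ ^ 2) :=
    fun i => (contDiff_coord i).mul hc2'
  have hmuls : ∀ i : Fin n, HasCompactSupport fun z : RH n => z i * deriv (deriv f) (‖z‖ ^ 2) :=
    fun i => hc2.mul_left
  have hgs : ∀ z : RH n, 1 ≤ ‖z‖ → 2 * deriv g (‖z‖ ^ 2) = 0 := by
    intro z hz
    rw [hgd, z2 _ (hq z hz), z3 _ (hq z hz)]; ring
  have hgc' : ContDiff ℝ (⊤ : ℕ∞) (deriv g) := (contDiff_infty_iff_deriv.1 hgc).2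
  refine ⟨fun z => f (‖z‖ ^ 2), fun z => 2 * deriv g (‖z‖ ^ 2), contDiff_comp_norm_sq hf,
    contDiff_const.mul (contDiff_comp_norm_sq hgc'),
    hasCompactSupport_of_eq_zero_of_one_le_norm fun z hz => z0 _ (hq z hz),
    hasCompactSupport_of_eq_zero_of_one_le_norm hgs, fun z hz => z0 _ (hq z hz.le),
    fun z hz => hgs z hz.le, ?_, ?_⟩
  · intro i z
    rw [cLaplacian_comp_norm_sq hf, cpderiv_comp_norm_sq hgc]
  · simp_rw [hσ]
    have hI : ∀ i : Fin n, Integrable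
        (cpderiv i (fun z : RH n => z i * deriv (deriv f) (‖z‖ ^ 2))) := fun i =>
      ((hmulc i).cpderiv i).continuous.integrable_of_hasCompactSupport ((hmuls i).cpderiv i)
    rw [integral_add ((hc2'.continuous.integrable_of_hasCompactSupport hc2).const_mul 8)
      ((integrable_finsetSum _ fun i _ => hI i).const_mul 4), integral_const_mul,
      integral_const_mul, integral_finsetSum _ fun i _ => hI i]
    simp_rw [integral_cpderiv_eq_zero (hmulc _) (hmuls _)]
    have := hc2'.continuous.integral_pos_of_hasCompactSupport_nonneg_nonzero
      (μ := (volume : Measure (RH n))) (x := 0) hc2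
      (fun z => hf2 _ (sq_nonneg _)) (by simpa using hf20)
    simpa using this

section WeightedTranslates

variable {P E F : Type*} [MeasurableSpace P] {m : Measure P} [NormedAddCommGroup E]
  [NormedAddCommGroup F] [NormedSpace ℝ F]

theorem integrable_smul_comp_sub {a : P → ℝ} (ha : Integrable a m) {γ : P → E}
    (hγ : AEStronglyMeasurable γ m) {w : E → F} (hw : Continuous w) (hwc : HasCompactSupport w)
    (x : E) : Integrable (fun p => a p • w (x - γ p)) m := by
  obtain ⟨C, hC⟩ := hw.bounded_above_of_compact_support hwc
  refine ha.smul_bdd C (hw.comp_aestronglyMeasurable ?_) (Eventually.of_forall fun p => hC _)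
  exact aestronglyMeasurable_const.sub hγ

variable [NormedSpace ℝ E]

theorem hasFDerivAt_integral_smul_comp_sub {a : P → ℝ} (ha : Integrable a m) {γ : P → E}
    (hγ : AEStronglyMeasurable γ m) {w : E → F} (hw : ContDiff ℝ 1 w) (hwc : HasCompactSupport w)
    (x : E) : HasFDerivAt (fun x => ∫ p, a p • w (x - γ p) ∂m)
      (∫ p, a p • fderiv ℝ w (x - γ p) ∂m) x := by
  have hw' : Continuous (fderiv ℝ w) := hw.continuous_fderiv (by simp)
  obtain ⟨C, hC⟩ := hw'.bounded_above_of_compact_support (hwc.fderiv ℝ)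
  refine hasFDerivAt_integral_of_dominated_of_fderiv_le (s := univ) (bound := fun p => ‖a p‖ * C)
    (F' := fun x p => a p • fderiv ℝ w (x - γ p)) univ_mem (Eventually.of_forall fun y =>
      (integrable_smul_comp_sub ha hγ hw.continuous hwc y).aestronglyMeasurable)
    (integrable_smul_comp_sub ha hγ hw.continuous hwc x)
    (integrable_smul_comp_sub ha hγ hw' (hwc.fderiv ℝ) x).aestronglyMeasurable
    (Eventually.of_forall fun p y _ => ?_) (ha.norm.mul_const C)
    (Eventually.of_forall fun p y _ => ?_)
  · rw [norm_smul]
    exact mul_le_mul_of_nonneg_left (hC _) (norm_nonneg _)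
  · have := ((hw.differentiable (by simp)) (y - γ p)).hasFDerivAt.comp y
      ((hasFDerivAt_id y).sub_const (γ p))
    exact this.const_smul (a p)

end WeightedTranslates

theorem contDiff_integral_smul_comp_sub.{u, v} {P : Type v} {E : Type u} [MeasurableSpace P]
    {m : Measure P} [NormedAddCommGroup E] [NormedSpace ℝ E] {a : P → ℝ} (ha : Integrable a m) {γ : P → E}
    (hγ : AEStronglyMeasurable γ m) (k : ℕ) : ∀ {F : Type u} [NormedAddCommGroup F]
    [NormedSpace ℝ F] {w : E → F}, ContDiff ℝ k w → HasCompactSupport w →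
      ContDiff ℝ k (fun x => ∫ p, a p • w (x - γ p) ∂m) := by
  induction k with
  | zero =>
    intro F _ _ w hw hwc
    have hw := hw.continuous
    obtain ⟨C, hC⟩ := hw.bounded_above_of_compact_support hwc
    refine contDiff_zero.2 (continuous_of_dominated (bound := fun p => ‖a p‖ * C)
      (fun y => (integrable_smul_comp_sub ha hγ hw hwc y).aestronglyMeasurable)
      (fun y => Eventually.of_forall fun p => ?_) (ha.norm.mul_const C)
      (Eventually.of_forall fun p => by fun_prop))
    rw [norm_smul]
    exact mul_le_mul_of_nonneg_left (hC _) (norm_nonneg _)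
  | succ k ih =>
    intro F _ _ w hw hwc
    have hw1 : ContDiff ℝ 1 w := hw.of_le (by exact_mod_cast Nat.le_add_left 1 k)
    refine contDiff_succ_iff_hasFDerivAt.2 ⟨fun x => ∫ p, a p • fderiv ℝ w (x - γ p) ∂m,
      ih (hw.fderiv_right (m := k) le_rfl) (hwc.fderiv ℝ), fun x =>
      hasFDerivAt_integral_smul_comp_sub ha hγ hw1 hwc x⟩

/-- The average `∫₀^ε t³ ∫ θ z * w (x - t z) dz dt` of `w` over translates at scales up to `ε`. -/
def scaleAverage (ε : ℝ) (θ w : RH n → ℝ) (x : RH n) : ℝ :=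
  ∫ p, (p.1 ^ 3 * θ p.2) • w (x - p.1 • p.2) ∂((volume.restrict (Ioc 0 ε)).prod volume)

theorem integrable_scaleAverage_weight {θ : RH n → ℝ} (hθ : Continuous θ)
    (hθc : HasCompactSupport θ) (ε : ℝ) :
    Integrable (fun p : ℝ × RH n => p.1 ^ 3 * θ p.2)
      ((volume.restrict (Ioc 0 ε)).prod volume) := by
  refine Integrable.mul_prod (f := fun t : ℝ => t ^ 3) ?_ (hθ.integrable_of_hasCompactSupport hθc)
  exact ((continuous_pow 3).integrableOn_Icc).mono_set Ioc_subset_Icc_self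

theorem aestronglyMeasurable_fst_smul_snd (m : Measure (ℝ × RH n)) :
    AEStronglyMeasurable (fun p : ℝ × RH n => p.1 • p.2) m :=
  (continuous_fst.smul continuous_snd).aestronglyMeasurable

theorem contDiff_scaleAverage {θ w : RH n → ℝ} (hθ : Continuous θ) (hθc : HasCompactSupport θ)
    (hw : ContDiff ℝ (⊤ : ℕ∞) w) (hwc : HasCompactSupport w) (ε : ℝ) :
    ContDiff ℝ (⊤ : ℕ∞) (scaleAverage ε θ w) :=
  contDiff_infty.2 fun k => contDiff_integral_smul_comp_sub
    (integrable_scaleAverage_weight hθ hθc ε) (aestronglyMeasurable_fst_smul_snd _) k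
    (contDiff_infty.1 hw k) hwc

theorem cpderiv_scaleAverage {θ w : RH n → ℝ} (hθ : Continuous θ) (hθc : HasCompactSupport θ)
    (hw : ContDiff ℝ (⊤ : ℕ∞) w) (hwc : HasCompactSupport w) (ε : ℝ) (i : Fin n) :
    cpderiv i (scaleAverage ε θ w) = scaleAverage ε θ (cpderiv i w) := by
  ext x
  have hw1 : ContDiff ℝ 1 w := hw.of_le (by exact_mod_cast le_top)
  have h := hasFDerivAt_integral_smul_comp_sub (integrable_scaleAverage_weight hθ hθc ε)
    (aestronglyMeasurable_fst_smul_snd _) hw1 hwc x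
  have hi := integrable_smul_comp_sub (integrable_scaleAverage_weight hθ hθc ε)
    (aestronglyMeasurable_fst_smul_snd _) (hw1.continuous_fderiv (by simp)) (hwc.fderiv ℝ) x
  change fderiv ℝ (fun x => ∫ p, (p.1 ^ 3 * θ p.2) • w (x - p.1 • p.2)
    ∂((volume.restrict (Ioc 0 ε)).prod volume)) x _ = _
  rw [h.fderiv, ContinuousLinearMap.integral_apply hi]
  rfl

theorem cLaplacian_scaleAverage {θ w : RH n → ℝ} (hθ : Continuous θ) (hθc : HasCompactSupport θ)
    (hw : ContDiff ℝ (⊤ : ℕ∞) w) (hwc : HasCompactSupport w) (ε : ℝ) :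
    cLaplacian (scaleAverage ε θ w) = scaleAverage ε θ (cLaplacian w) := by
  ext x
  simp only [cLaplacian]
  simp_rw [cpderiv_scaleAverage hθ hθc hw hwc,
    cpderiv_scaleAverage hθ hθc (hw.cpderiv _) (hwc.cpderiv _)]
  simp only [scaleAverage]
  rw [← integral_finsetSum _ fun i _ => integrable_smul_comp_sub
    (integrable_scaleAverage_weight hθ hθc ε) (aestronglyMeasurable_fst_smul_snd _)
    ((hw.cpderiv i).cpderiv i).continuous ((hwc.cpderiv i).cpderiv i) x]
  refine integral_congr_ae (Eventually.of_forall fun p => ?_)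
  simp only [cLaplacian, Finset.smul_sum]

theorem scaleAverage_eq_integral {θ w : RH n → ℝ} (hθ : Continuous θ)
    (hθc : HasCompactSupport θ) (hw : Continuous w) (hwc : HasCompactSupport w) (ε : ℝ)
    (x : RH n) :
    scaleAverage ε θ w x = ∫ t in Ioc 0 ε, t ^ 3 * ∫ z, θ z * w (x - t • z) := by
  rw [scaleAverage, integral_prod _ (integrable_smul_comp_sub
    (integrable_scaleAverage_weight hθ hθc ε) (aestronglyMeasurable_fst_smul_snd _) hw hwc x)]
  simp_rw [← integral_const_mul, smul_eq_mul, mul_assoc]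

/-- The averaged function vanishes away from the `ε`-neighbourhood of the support. -/
theorem support_scaleAverage_subset {θ w : RH n → ℝ} (hθ : ∀ z, 1 < ‖z‖ → θ z = 0) (ε : ℝ) :
    Function.support (scaleAverage ε θ w) ⊆ cthickening ε (tsupport w) := by
  intro x hx
  by_contra hxn
  refine hx ?_
  have : ∀ᵐ p ∂((volume.restrict (Ioc 0 ε)).prod (volume : Measure (RH n))),
      (p.1 ^ 3 * θ p.2) • w (x - p.1 • p.2) = 0 := by
    have h : ∀ᵐ p ∂((volume.restrict (Ioc 0 ε)).prod (volume : Measure (RH n))),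
        p.1 ∈ Ioc 0 ε :=
      Measure.quasiMeasurePreserving_fst.ae (ae_restrict_mem measurableSet_Ioc)
    filter_upwards [h] with p hp
    by_cases hz : 1 < ‖p.2‖
    · simp [hθ _ hz]
    · by_cases hxw : x - p.1 • p.2 ∈ tsupport w
      · exact absurd (mem_cthickening_of_dist_le x _ ε _ hxw (by
          rw [dist_eq_norm, sub_sub_cancel, norm_smul, Real.norm_of_nonneg hp.1.le]
          nlinarith [hp.1, hp.2, norm_nonneg p.2])) hxn
      · simp [image_eq_zero_of_notMem_tsupport hxw]
  rw [scaleAverage, integral_congr_ae this, integral_zero]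

/-- The bi-Laplacian of the averaged function recovers the original function up to a smooth
error at scale `ε`. -/
theorem scaleAverage_cLaplacian_cLaplacian {θ σ w : RH n → ℝ} (hθ : ContDiff ℝ (⊤ : ℕ∞) θ)
    (hθc : HasCompactSupport θ) (hσ : Continuous σ) (hσc : HasCompactSupport σ)
    (hθσ : ∀ i z, cpderiv i (cLaplacian θ) z = z i * σ z)
    (hw : ContDiff ℝ (⊤ : ℕ∞) w) (hwc : HasCompactSupport w) {ε : ℝ} (hε : 0 ≤ ε) (x : RH n) :
    scaleAverage ε θ (cLaplacian (cLaplacian w)) x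
      = (∫ z, σ z) * w x - ∫ z, σ z * w (x - ε • z) := by
  rw [scaleAverage_eq_integral hθ.continuous hθc hw.cLaplacian.cLaplacian.continuous
    hwc.cLaplacian.cLaplacian]
  simp_rw [pow_three_mul_integral_mul_cLaplacian_cLaplacian_sub_smul hθ hθc hw, hθσ]
  have hw' : Continuous (fderiv ℝ w) := hw.continuous_fderiv (by simp)
  have hsum : ∀ (t : ℝ) (z : RH n), ∑ i, z i * σ z * cpderiv i w (x - t • z)
      = σ z * fderiv ℝ w (x - t • z) z := by
    intro t z
    have hz : ∀ A : RH n →L[ℝ] ℝ, A z = ∑ i, z i * A (EuclideanSpace.single i 1) := by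
      intro A
      conv_lhs => rw [← (EuclideanSpace.basisFun (Fin n) ℝ).sum_repr z, map_sum]
      simp
    rw [hz, Finset.mul_sum]
    exact Finset.sum_congr rfl fun i _ => by rw [cpderiv]; ring
  simp_rw [hsum]
  have hcont : Continuous (fun p : ℝ × RH n => σ p.2 * fderiv ℝ w (x - p.1 • p.2) p.2) :=
    (hσ.comp continuous_snd).mul
      ((hw'.comp (by fun_prop : Continuous fun p : ℝ × RH n => x - p.1 • p.2)).clm_apply
        continuous_snd)
  have hint : Integrable (fun p : ℝ × RH n => σ p.2 * fderiv ℝ w (x - p.1 • p.2) p.2)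
      ((volume.restrict (Ioc 0 ε)).prod volume) := by
    have hK : IsCompact (Icc 0 ε ×ˢ tsupport σ) := isCompact_Icc.prod hσc
    have h1 := hcont.continuousOn.integrableOn_compact (μ := (volume : Measure ℝ).prod volume) hK
    have h2 : IntegrableOn (fun p : ℝ × RH n => σ p.2 * fderiv ℝ w (x - p.1 • p.2) p.2)
        (Icc 0 ε ×ˢ univ) ((volume : Measure ℝ).prod volume) := by
      refine h1.of_forall_sdiff_eq_zero (measurableSet_Icc.prod MeasurableSet.univ) ?_
      rintro p ⟨hp, hp'⟩
      have : p.2 ∉ tsupport σ := fun h => hp' ⟨hp.1, h⟩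
      simp [image_eq_zero_of_notMem_tsupport this]
    have h3 := h2.mono_set (prod_mono_left (t := (univ : Set (RH n))) Ioc_subset_Icc_self)
    rwa [IntegrableOn, ← Measure.prod_restrict, Measure.restrict_univ] at h3
  rw [integral_integral_swap hint]
  have hftc : ∀ z, ∫ t in Ioc 0 ε, σ z * fderiv ℝ w (x - t • z) z
      = σ z * w x - σ z * w (x - ε • z) := by
    intro z
    rw [← intervalIntegral.integral_of_le hε]
    have hd : ∀ t ∈ uIcc 0 ε, HasDerivAt (fun t : ℝ => - (σ z * w (x - t • z)))
        (σ z * fderiv ℝ w (x - t • z) z) t := by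
      intro t _
      have h1 : HasDerivAt (fun t : ℝ => x - t • z) (-z) t := by
        simpa using ((hasDerivAt_id t).smul_const z).const_sub x
      have h2 := ((hw.differentiable (by simp)) (x - t • z)).hasFDerivAt.comp_hasDerivAt t h1
      exact (h2.const_mul (σ z)).neg.congr_deriv (by simp)
    rw [intervalIntegral.integral_eq_sub_of_hasDerivAt hd]
    · simp; ring
    · refine Continuous.intervalIntegrable ?_ _ _
      exact hcont.comp (by fun_prop : Continuous fun t : ℝ => (t, z))
  simp_rw [hftc]
  rw [integral_sub ((hσ.integrable_of_hasCompactSupport hσc).mul_const _)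
    (integrable_mul_comp_sub_smul hσ hσc hw.continuous x ε), integral_mul_const]

/-- The kernel `∫₀^ε t⁻ⁿ η (x / t) dt`. -/
def scaleKernel (ε : ℝ) (η : RH n → ℝ) (x : RH n) : ℝ :=
  ∫ t in Ioc 0 ε, (t ^ n)⁻¹ * η (t⁻¹ • x)

theorem stronglyMeasurable_scaleKernel {η : RH n → ℝ} (hη : Continuous η) (ε : ℝ) :
    StronglyMeasurable (scaleKernel ε η) := by
  have h : Measurable fun p : RH n × ℝ => (p.2 ^ n)⁻¹ * η (p.2⁻¹ • p.1) :=
    (measurable_snd.pow_const n).inv.mul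
      (hη.measurable.comp (measurable_snd.inv.smul measurable_fst))
  exact h.stronglyMeasurable.integral_prod_right'

theorem scaleKernel_eq_zero {η : RH n → ℝ} (hη : ∀ z, 1 < ‖z‖ → η z = 0) {ε : ℝ} {x : RH n}
    (hx : ε < ‖x‖) : scaleKernel ε η x = 0 := by
  refine setIntegral_eq_zero_of_forall_eq_zero fun t ht => ?_
  rw [hη, mul_zero]
  rw [norm_smul, norm_inv, Real.norm_of_nonneg ht.1.le, inv_mul_eq_div, one_lt_div ht.1]
  exact ht.2.trans_lt hx

theorem norm_scaleKernel_le (hn : 2 ≤ n) {η : RH n → ℝ} (hη : ∀ z, 1 < ‖z‖ → η z = 0) {C : ℝ}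
    (hC : ∀ z, ‖η z‖ ≤ C) (ε : ℝ) {x : RH n} (hx : x ≠ 0) :
    ‖scaleKernel ε η x‖ ≤ C / (n - 1) * ‖x‖ ^ (1 - (n : ℝ)) := by
  have hx0 : 0 < ‖x‖ := norm_pos_iff.2 hx
  have hn' : (2 : ℝ) ≤ n := by exact_mod_cast hn
  have hC0 : 0 ≤ C := (norm_nonneg _).trans (hC 0)
  have hb : ∀ t ∈ Ioc 0 ε, ‖(t ^ n)⁻¹ * η (t⁻¹ • x)‖
      ≤ (Ici ‖x‖).indicator (fun t : ℝ => C * t ^ (-(n : ℝ))) t := by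
    intro t ht
    by_cases htx : ‖x‖ ≤ t
    · rw [indicator_of_mem (mem_Ici.2 htx), norm_mul, norm_inv, norm_pow,
        Real.norm_of_nonneg ht.1.le, Real.rpow_neg ht.1.le, Real.rpow_natCast, mul_comm]
      have := ht.1
      exact mul_le_mul_of_nonneg_right (hC _) (by positivity)
    · rw [indicator_of_notMem (by simpa using htx), hη, mul_zero, norm_zero]
      rw [norm_smul, norm_inv, Real.norm_of_nonneg ht.1.le, inv_mul_eq_div, one_lt_div ht.1]
      exact not_le.1 htx
  have hi : IntegrableOn (fun t : ℝ => C * t ^ (-(n : ℝ))) (Ici ‖x‖) :=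
    (integrableOn_Ici_iff_integrableOn_Ioi enorm_ne_top).2
      ((integrableOn_Ioi_rpow_of_lt (by linarith) hx0).const_mul C)
  have hi' := (integrable_indicator_iff measurableSet_Ici).2 hi
  calc ‖scaleKernel ε η x‖
      ≤ ∫ t in Ioc 0 ε, (Ici ‖x‖).indicator (fun t : ℝ => C * t ^ (-(n : ℝ))) t :=
        norm_integral_le_of_norm_le hi'.integrableOn
          ((ae_restrict_iff' measurableSet_Ioc).2 (Eventually.of_forall hb))
    _ ≤ ∫ t, (Ici ‖x‖).indicator (fun t : ℝ => C * t ^ (-(n : ℝ))) t := by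
        refine setIntegral_le_integral hi' (Eventually.of_forall fun t => ?_)
        refine indicator_nonneg (fun t ht => ?_) t
        have : 0 < t := hx0.trans_le ht
        positivity
    _ = C / (n - 1) * ‖x‖ ^ (1 - (n : ℝ)) := by
        rw [integral_indicator measurableSet_Ici, integral_Ici_eq_integral_Ioi,
          integral_const_mul, integral_Ioi_rpow_of_lt (by linarith) hx0,
          show -(n : ℝ) + 1 = -(n - 1) by ring, show 1 - (n : ℝ) = -(n - 1) by ring,
          neg_div_neg_eq]
        ring

theorem memLp_scaleKernel (hn : 2 ≤ n) {η : RH n → ℝ} (hηc : Continuous η)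
    (hη : ∀ z, 1 < ‖z‖ → η z = 0) {C : ℝ} (hC : ∀ z, ‖η z‖ ≤ C) (ε : ℝ) {q : ℝ} (hq1 : 1 ≤ q)
    (hq : q < (n : ℝ) / ((n : ℝ) - 1)) :
    MemLp (scaleKernel ε η) (ENNReal.ofReal q) volume := by
  have hn' : (2 : ℝ) ≤ n := by exact_mod_cast hn
  have hn1 : 0 < (n : ℝ) - 1 := by linarith
  have hC0 : 0 ≤ C := (norm_nonneg _).trans (hC 0)
  have hm := (stronglyMeasurable_scaleKernel hηc ε).aestronglyMeasurable (μ := volume)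
  have hq0 : ENNReal.ofReal q ≠ 0 := by simp; linarith
  have hind : (ball (0 : RH n) (|ε| + 1)).indicator (scaleKernel ε η) = scaleKernel ε η := by
    refine indicator_eq_self.2 fun x hx => ?_
    by_contra hxn
    refine hx (scaleKernel_eq_zero hη ?_)
    rw [mem_ball_zero_iff, not_lt] at hxn
    linarith [le_abs_self ε]
  rw [← hind, memLp_indicator_iff_restrict measurableSet_ball,
    ← integrable_norm_rpow_iff hm.restrict hq0 ENNReal.ofReal_ne_top,
    ENNReal.toReal_ofReal (by linarith)]
  have hpow : IntegrableOn (fun x : RH n => (fun r : ℝ => (C / (n - 1) * r ^ (1 - (n : ℝ))) ^ q) ‖x‖)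
      (ball 0 (|ε| + 1)) := by
    have : Nontrivial (RH n) := by
      have : Nonempty (Fin n) := ⟨⟨0, by omega⟩⟩
      infer_instance
    refine (integrableOn_fun_norm_addHaar (μ := volume)
      (f := fun r : ℝ => (C / (n - 1) * r ^ (1 - (n : ℝ))) ^ q)).2 ?_
    have hexp : -1 < (n - 1) + (1 - (n : ℝ)) * q := by
      rw [lt_div_iff₀ hn1] at hq; nlinarith
    have h1 : IntegrableOn (fun r : ℝ => (C / (n - 1)) ^ q * r ^ ((n - 1) + (1 - (n : ℝ)) * q))
        (Ioo 0 (|ε| + 1)) :=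
      ((intervalIntegral.integrableOn_Ioo_rpow_iff (by positivity)).2 hexp).const_mul _
    refine h1.congr_fun (fun r hr => ?_) measurableSet_Ioo
    have hr0 : 0 < r := hr.1
    simp only [finrank_euclideanSpace, Fintype.card_fin, smul_eq_mul]
    rw [Real.mul_rpow (by positivity) (by positivity), ← Real.rpow_mul hr0.le,
      Real.rpow_add hr0, ← Real.rpow_natCast r (n - 1), Nat.cast_sub (by omega)]
    push_cast
    ring
  refine Integrable.mono' hpow (hm.restrict.norm.aemeasurable.pow_const q).aestronglyMeasurable ?_
  have hne : ∀ᵐ x : RH n, x ≠ 0 := by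
    have : Nontrivial (RH n) := by
      have : Nonempty (Fin n) := ⟨⟨0, by omega⟩⟩
      infer_instance
    simp [ae_iff]
  filter_upwards [ae_restrict_of_ae hne] with x hx
  rw [Real.norm_of_nonneg (by positivity)]
  exact Real.rpow_le_rpow (norm_nonneg _) (norm_scaleKernel_le hn hη hC ε hx) (by linarith)

theorem integral_mul_comp_sub_smul_eq {t : ℝ} (ht : 0 < t) (η φ : RH n → ℝ) (x : RH n) :
    ∫ z, η z * φ (x - t • z) = ∫ y, (t ^ n)⁻¹ * η (t⁻¹ • (x - y)) * φ y := by
  rw [← integral_sub_left_eq_self (fun y => (t ^ n)⁻¹ * η (t⁻¹ • (x - y)) * φ y) volume x]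
  have h := Measure.integral_comp_inv_smul_of_nonneg (volume : Measure (RH n))
    (fun z => (t ^ n)⁻¹ * (η z * φ (x - t • z))) ht.le
  simp only [smul_inv_smul₀ ht.ne', integral_const_mul, finrank_euclideanSpace, Fintype.card_fin,
    smul_eq_mul] at h
  simp only [sub_sub_cancel, mul_assoc, integral_const_mul]
  rw [h]
  field_simp

theorem integral_scaleKernel_mul {η φ : RH n → ℝ} (hη : Continuous η) (hηs : HasCompactSupport η)
    (hφ : Continuous φ) (hφs : HasCompactSupport φ) (ε : ℝ) (x : RH n) :
    ∫ t in Ioc 0 ε, ∫ z, η z * φ (x - t • z) = ∫ y, scaleKernel ε η (x - y) * φ y := by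
  obtain ⟨C, hC⟩ := hφ.bounded_above_of_compact_support hφs
  rw [setIntegral_congr_fun measurableSet_Ioc fun t ht =>
    integral_mul_comp_sub_smul_eq ht.1 η φ x]
  have hmeas : Measurable fun p : ℝ × RH n => (p.1 ^ n)⁻¹ * η (p.1⁻¹ • (x - p.2)) * φ p.2 :=
    ((measurable_fst.pow_const n).inv.mul (hη.measurable.comp
      (measurable_fst.inv.smul (measurable_snd.const_sub x)))).mul (hφ.measurable.comp measurable_snd)
  have hint : Integrable (fun p : ℝ × RH n => (p.1 ^ n)⁻¹ * η (p.1⁻¹ • (x - p.2)) * φ p.2)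
      ((volume.restrict (Ioc 0 ε)).prod volume) := by
    refine (integrable_prod_iff hmeas.aestronglyMeasurable).2 ⟨Eventually.of_forall fun t => ?_, ?_⟩
    · have hη' : Continuous fun y => η (t⁻¹ • (x - y)) :=
        hη.comp ((continuous_const.sub continuous_id).const_smul t⁻¹)
      exact (((continuous_const (y := (t ^ n)⁻¹)).mul hη').mul hφ).integrable_of_hasCompactSupport
        (μ := (volume : Measure (RH n))) hφs.mul_left
    · refine Integrable.mono' (g := fun _ => ∫ z, ‖η z‖ * C) (by simp)
        hmeas.stronglyMeasurable.norm.integral_prod_right'.aestronglyMeasurable ?_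
      filter_upwards [ae_restrict_mem measurableSet_Ioc] with t ht
      have h0 : 0 < t := ht.1
      rw [Real.norm_of_nonneg (integral_nonneg fun _ => norm_nonneg _)]
      simp only [norm_mul, norm_inv, norm_pow, Real.norm_of_nonneg h0.le]
      rw [← integral_mul_comp_sub_smul_eq h0 (fun z => ‖η z‖) (fun z => ‖φ z‖) x]
      have := hη.integrable_of_hasCompactSupport (μ := volume) hηs
      refine integral_mono (integrable_mul_comp_sub_smul hη.norm hηs.norm hφ.norm x t)
        (this.norm.mul_const C) fun z => ?_
      exact mul_le_mul_of_nonneg_left (hC _) (norm_nonneg _)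
  rw [integral_integral_swap hint]
  simp only [integral_mul_const]
  rfl

theorem lintegral_rpow_le_measure_univ_rpow_mul {α : Type*} [MeasurableSpace α] (ν : Measure α)
    {f : α → ℝ≥0∞} (hf : AEMeasurable f ν) {q : ℝ} (hq : 1 ≤ q) :
    (∫⁻ x, f x ∂ν) ^ q ≤ ν univ ^ (q - 1) * ∫⁻ x, f x ^ q ∂ν := by
  have hq0 : 0 < q := by linarith
  have h := eLpNorm'_le_eLpNorm'_mul_rpow_measure_univ (μ := ν) one_pos hq hf.aestronglyMeasurable
  simp only [eLpNorm', enorm_eq_self, ENNReal.rpow_one, div_one] at h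
  refine (ENNReal.rpow_le_rpow h hq0.le).trans (le_of_eq ?_)
  rw [ENNReal.mul_rpow_of_nonneg _ _ hq0.le, ← ENNReal.rpow_mul, ← ENNReal.rpow_mul,
    one_div_mul_cancel hq0.ne', ENNReal.rpow_one, mul_comm]
  congr 2
  field_simp

/-- The potential of a finite measure with an `L^q` kernel is in `L^q`. -/
theorem memLp_integral_comp_sub {N : RH n → ℝ} (hN : StronglyMeasurable N) {q : ℝ} (hq : 1 ≤ q)
    (hNq : MemLp N (ENNReal.ofReal q) volume) (ν : Measure (RH n)) [IsFiniteMeasure ν] :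
    MemLp (fun y => ∫ x, N (x - y) ∂ν) (ENNReal.ofReal q) volume := by
  have hq0 : 0 < q := by linarith
  have hm : StronglyMeasurable fun p : RH n × RH n => N (p.2 - p.1) :=
    hN.comp_measurable (measurable_snd.sub measurable_fst)
  have hq0' : ENNReal.ofReal q ≠ 0 := by simpa using hq0
  refine ⟨hm.integral_prod_right'.aestronglyMeasurable, ?_⟩
  rw [eLpNorm_lt_top_iff_lintegral_rpow_enorm_lt_top hq0' ENNReal.ofReal_ne_top,
    ENNReal.toReal_ofReal hq0.le]
  have hNfin := (eLpNorm_lt_top_iff_lintegral_rpow_enorm_lt_top hq0' ENNReal.ofReal_ne_top).1 hNq.2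
  rw [ENNReal.toReal_ofReal hq0.le] at hNfin
  calc ∫⁻ y, ‖∫ x, N (x - y) ∂ν‖ₑ ^ q
      ≤ ∫⁻ y, ν univ ^ (q - 1) * ∫⁻ x, ‖N (x - y)‖ₑ ^ q ∂ν := by
        refine lintegral_mono fun y => ?_
        refine (ENNReal.rpow_le_rpow (enorm_integral_le_lintegral_enorm _) hq0.le).trans ?_
        refine lintegral_rpow_le_measure_univ_rpow_mul ν ?_ hq
        exact (hN.comp_measurable (measurable_id.sub_const y)).enorm.aemeasurable
    _ = ν univ ^ (q - 1) * ∫⁻ x, (∫⁻ y, ‖N (x - y)‖ₑ ^ q) ∂ν := by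
        have hm' : AEMeasurable (fun p : RH n × RH n => ‖N (p.2 - p.1)‖ₑ ^ q)
            (volume.prod ν) := (hm.enorm.pow_const q).aemeasurable
        rw [lintegral_const_mul _ ((hm.enorm.pow_const q).lintegral_prod_right'),
          lintegral_lintegral_swap hm']
    _ = ν univ ^ (q - 1) * (ν univ * ∫⁻ y, ‖N y‖ₑ ^ q) := by
        simp_rw [lintegral_sub_left_eq_self (fun y => ‖N y‖ₑ ^ q) , lintegral_const, mul_comm]
    _ < ⊤ := ENNReal.mul_lt_top (ENNReal.rpow_lt_top_of_nonneg (by linarith) (by finiteness))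
        (ENNReal.mul_lt_top (by finiteness) hNfin)

theorem integrable_mul_comp_sub_prod {N a : RH n → ℝ} (hN : StronglyMeasurable N)
    (hNi : Integrable N) {ν : Measure (RH n)} [SFinite ν] (ha : Integrable a ν) :
    Integrable (fun p : RH n × RH n => a p.1 * N (p.1 - p.2)) (ν.prod volume) := by
  have hm : AEStronglyMeasurable (fun p : RH n × RH n => a p.1 * N (p.1 - p.2)) (ν.prod volume) :=
    ha.aestronglyMeasurable.comp_fst.mul
      (hN.comp_measurable (measurable_fst.sub measurable_snd)).aestronglyMeasurable
  refine (integrable_prod_iff hm).2 ⟨Eventually.of_forall fun x =>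
    (hNi.comp_sub_left x).const_mul (a x), ?_⟩
  simp only [norm_mul, integral_const_mul, integral_sub_left_eq_self (fun y => ‖N y‖) volume]
  exact ha.norm.mul_const _

theorem integral_mul_integral_comp_sub_mul {N a φ : RH n → ℝ} (hN : StronglyMeasurable N)
    (hNi : Integrable N) {ν : Measure (RH n)} [SFinite ν] (ha : Integrable a ν)
    (hφ : Continuous φ) (hφs : HasCompactSupport φ) :
    Integrable (fun y => (∫ x, a x * N (x - y) ∂ν) * φ y) ∧
    ∫ x, a x * (∫ y, N (x - y) * φ y) ∂ν = ∫ y, (∫ x, a x * N (x - y) ∂ν) * φ y := by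
  obtain ⟨C, hC⟩ := hφ.bounded_above_of_compact_support hφs
  have hi := (integrable_mul_comp_sub_prod hN hNi ha).mul_bdd (c := C) (g := fun p => φ p.2)
    (hφ.comp continuous_snd).aestronglyMeasurable (Eventually.of_forall fun p => hC _)
  have hswap := integral_integral_swap (f := fun x y => a x * N (x - y) * φ y) hi
  refine ⟨?_, ?_⟩
  · have := hi.integral_prod_right
    simpa only [integral_mul_const] using this
  · simpa only [← integral_mul_const, ← integral_const_mul, mul_assoc] using hswap

theorem exists_biLaplacian_potential (hn : 2 ≤ n) {ε : ℝ} (hε : 0 < ε) (i j l : Fin n) :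
    ∃ c : ℝ, 0 < c ∧ ∃ M N : RH n → ℝ, StronglyMeasurable M ∧
      (∀ q : ℝ, 1 ≤ q → q < (n : ℝ) / ((n : ℝ) - 1) → MemLp M (ENNReal.ofReal q) volume) ∧
      Continuous N ∧ HasCompactSupport N ∧
      ∀ φ : RH n → ℝ, ContDiff ℝ (⊤ : ℕ∞) φ → HasCompactSupport φ →
        ∃ T : RH n → ℝ, ContDiff ℝ (⊤ : ℕ∞) T ∧
          Function.support T ⊆ cthickening ε (tsupport φ) ∧
          (∀ x, T x = ∫ y, M (x - y) * φ y) ∧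
          ∀ x, cLaplacian (cLaplacian T) x
            = c * cpderiv i (cpderiv j (cpderiv l φ)) x - ∫ y, N (x - y) * φ y := by
  obtain ⟨θ, σ, hθ, hσ, hθc, hσc, hθ1, -, hθσ, hc⟩ := exists_cLaplacian_gradient_profile n
  have hη := ((hθ.cpderiv i).cpderiv j).cpderiv l
  have hηc := ((hθc.cpderiv i).cpderiv j).cpderiv l
  have hη1 : ∀ z, 1 < ‖z‖ → cpderiv l (cpderiv j (cpderiv i θ)) z = 0 := by
    have hsub : tsupport θ ⊆ closedBall 0 1 := by
      refine closure_minimal (fun z hz => ?_) isClosed_closedBall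
      rw [mem_closedBall_zero_iff]
      by_contra hz1
      exact hz (hθ1 z (not_le.1 hz1))
    intro z hz
    refine image_eq_zero_of_notMem_tsupport fun hzt => hz.not_ge ?_
    exact mem_closedBall_zero_iff.1 (hsub (tsupport_cpderiv_subset _ _
      (tsupport_cpderiv_subset _ _ (tsupport_cpderiv_subset _ _ hzt))))
  obtain ⟨C, hC⟩ := hη.continuous.bounded_above_of_compact_support hηc
  have hσ3 := ((hσ.cpderiv i).cpderiv j).cpderiv l
  have hσ3c := ((hσc.cpderiv i).cpderiv j).cpderiv l
  refine ⟨∫ z, σ z, hc, scaleKernel ε (cpderiv l (cpderiv j (cpderiv i θ))),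
    fun x => (ε ^ 3)⁻¹ * ((ε ^ n)⁻¹ * cpderiv l (cpderiv j (cpderiv i σ)) (ε⁻¹ • x)),
    stronglyMeasurable_scaleKernel hη.continuous ε,
    fun q hq1 hq => memLp_scaleKernel hn hη.continuous hη1 hC ε hq1 hq, ?_, ?_, ?_⟩
  · exact continuous_const.mul (continuous_const.mul
      (hσ3.continuous.comp (continuous_id.const_smul ε⁻¹)))
  · exact ((hσ3c.comp_smul (inv_ne_zero hε.ne')).mul_left).mul_left
  intro φ hφ hφc
  have hw := ((hφ.cpderiv l).cpderiv j).cpderiv i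
  have hwc := ((hφc.cpderiv l).cpderiv j).cpderiv i
  refine ⟨scaleAverage ε θ (cpderiv i (cpderiv j (cpderiv l φ))),
    contDiff_scaleAverage hθ.continuous hθc hw hwc ε, ?_, fun x => ?_, fun x => ?_⟩
  · exact (support_scaleAverage_subset hθ1 ε).trans (cthickening_subset_of_subset ε
      ((tsupport_cpderiv_subset _ _).trans ((tsupport_cpderiv_subset _ _).trans
        (tsupport_cpderiv_subset _ _))))
  · rw [scaleAverage_eq_integral hθ.continuous hθc hw.continuous hwc]
    simp_rw [pow_three_mul_integral_mul_cpderiv_sub_smul hθ hθc hφ]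
    exact integral_scaleKernel_mul hη.continuous hηc hφ.continuous hφc ε x
  · rw [cLaplacian_scaleAverage hθ.continuous hθc hw hwc,
      cLaplacian_scaleAverage hθ.continuous hθc hw.cLaplacian hwc.cLaplacian,
      scaleAverage_cLaplacian_cLaplacian hθ hθc hσ.continuous hσc hθσ hw hwc hε.le]
    congr 1
    simp_rw [mul_assoc (ε ^ 3)⁻¹]
    rw [integral_const_mul, ← integral_mul_comp_sub_smul_eq hε,
      ← pow_three_mul_integral_mul_cpderiv_sub_smul hσ hσc hφ, inv_mul_cancel_left₀ (by positivity)]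

theorem IsH2With.setIntegral_mul_cpderiv {Ω : Set (RH n)} {v : RH n → ℝ} {g : Fin n → RH n → ℝ}
    {h : Fin n → Fin n → RH n → ℝ} (hv : IsH2With Ω v g h) (i j l : Fin n) {φ : RH n → ℝ}
    (hφ : IsTestFun Ω φ) :
    ∫ x in Ω, v x * cpderiv i (cpderiv j (cpderiv l φ)) x = ∫ x in Ω, h i j x * cpderiv l φ x := by
  rw [(hv.2.1 i).1 _ ((hφ.cpderiv l).cpderiv j), (hv.2.2 i j).1 _ (hφ.cpderiv l), neg_neg]

theorem memLp_integral_mul_comp_sub {N a : RH n → ℝ} (hN : Continuous N)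
    (hNc : HasCompactSupport N) {ν : Measure (RH n)} [SFinite ν] (ha : Integrable a ν)
    {U : Set (RH n)} (hU : volume U ≠ ⊤) (q : ℝ≥0∞) :
    MemLp (fun y => ∫ x, a x * N (x - y) ∂ν) q (volume.restrict U) := by
  obtain ⟨C, hC⟩ := hN.bounded_above_of_compact_support hNc
  have : IsFiniteMeasure (volume.restrict U) := isFiniteMeasure_restrict.2 hU
  have hi := integrable_mul_comp_sub_prod hN.stronglyMeasurable
    (hN.integrable_of_hasCompactSupport hNc) ha
  refine MemLp.of_bound hi.integral_prod_right.aestronglyMeasurable.restrict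
    (∫ x, ‖a x‖ * C ∂ν) (Eventually.of_forall fun y => ?_)
  refine norm_integral_le_of_norm_le (ha.norm.mul_const C) (Eventually.of_forall fun x => ?_)
  rw [norm_mul]
  exact mul_le_mul_of_nonneg_left (hC _) (norm_nonneg _)

theorem memLp_of_memLp_two {Ω U : Set (RH n)} {f : RH n → ℝ}
    (hf : MemLp f 2 (volume.restrict Ω)) (hU : U ⊆ Ω) (hUfin : volume U ≠ ⊤) {q : ℝ}
    (hq : q ≤ 2) : MemLp f (ENNReal.ofReal q) (volume.restrict U) := by
  have : IsFiniteMeasure (volume.restrict U) := isFiniteMeasure_restrict.2 hUfin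
  refine (hf.mono_measure (Measure.restrict_mono_set volume hU)).mono_exponent ?_
  simpa using ENNReal.ofReal_le_ofReal hq

/-- The third weak derivatives of a weak solution of `Δ²v = μ⁺ - μ⁻`. -/
theorem exists_isWeakPartial_hessian (hn : 2 ≤ n) {Ω : Set (RH n)} (hΩ : IsOpen Ω)
    {v : RH n → ℝ} {g : Fin n → RH n → ℝ} {h : Fin n → Fin n → RH n → ℝ} (hv : IsH2With Ω v g h)
    {μp μn : Measure (RH n)} (hμp : ∀ K ⊆ Ω, IsCompact K → μp K < ⊤)
    (hμn : ∀ K ⊆ Ω, IsCompact K → μn K < ⊤)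
    (hrep : ∀ φ : RH n → ℝ, IsTestFun Ω φ → ∫ x in Ω, v x * cLaplacian (cLaplacian φ) x
      = (∫ x in Ω, φ x ∂μp) - ∫ x in Ω, φ x ∂μn)
    {U : Set (RH n)} (hUc : IsCompact (closure U)) (hUΩ : closure U ⊆ Ω)
    {q : ℝ} (hq1 : 1 ≤ q) (hq : q < (n : ℝ) / ((n : ℝ) - 1)) (i j l : Fin n) :
    ∃ k : RH n → ℝ, IsWeakPartial U l (h i j) k ∧ MemLp k (ENNReal.ofReal q) (volume.restrict U) := by
  obtain ⟨ε, hε, hεΩ⟩ := hUc.exists_cthickening_subset_open hΩ hUΩ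
  set K := cthickening ε (closure U)
  have hKc : IsCompact K := hUc.cthickening
  have hUK : U ⊆ K := subset_closure.trans (self_subset_cthickening _)
  have hUfin : volume U ≠ ⊤ := ((measure_mono hUK).trans_lt hKc.measure_lt_top).ne
  have : IsFiniteMeasure (μp.restrict K) := isFiniteMeasure_restrict.2 (hμp K hεΩ hKc).ne
  have : IsFiniteMeasure (μn.restrict K) := isFiniteMeasure_restrict.2 (hμn K hεΩ hKc).ne
  have : IsFiniteMeasure ((volume : Measure (RH n)).restrict K) :=
    isFiniteMeasure_restrict.2 hKc.measure_lt_top.ne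
  have hvK : Integrable v (volume.restrict K) :=
    (hv.1.mono_measure (Measure.restrict_mono_set volume hεΩ)).integrable (by norm_num)
  obtain ⟨c, hc, M, N, hM, hMq, hN, hNc, hpot⟩ := exists_biLaplacian_potential hn hε i j l
  have hMi : Integrable M := by
    have hn' : (2 : ℝ) ≤ n := by exact_mod_cast hn
    have := hMq 1 le_rfl (by rw [lt_div_iff₀ (by linarith)]; linarith)
    rwa [ENNReal.ofReal_one, memLp_one_iff_integrable] at this
  have hNi := hN.integrable_of_hasCompactSupport (μ := volume) hNc
  refine ⟨fun y => -c⁻¹ * (((∫ x in K, M (x - y) ∂μp) - ∫ x in K, M (x - y) ∂μn)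
    + ∫ x in K, v x * N (x - y)), fun φ hφ => ?_, ?_⟩
  · have hφΩ := hφ.mono (subset_closure.trans hUΩ)
    obtain ⟨T, hT, hTs, hTM, hTN⟩ := hpot φ hφ.1 hφ.2.1
    have hTK : Function.support T ⊆ K :=
      hTs.trans (cthickening_subset_of_subset ε (hφ.2.2.trans subset_closure))
    have hTtest : IsTestFun Ω T :=
      ⟨hT, hKc.of_isClosed_subset isClosed_closure (closure_minimal hTK hKc.isClosed),
        (closure_minimal hTK hKc.isClosed).trans hεΩ⟩
    have hTint : ∀ ν : Measure (RH n), ∫ x in Ω, T x ∂ν = ∫ x in K, T x ∂ν := fun ν =>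
      setIntegral_eq_of_subset_of_forall_sdiff_eq_zero hΩ.measurableSet hεΩ fun x hx => by
        by_contra hx0
        exact hx.2 (hTK hx0)
    have hT2 : IsTestFun K (cLaplacian (cLaplacian T)) :=
      IsTestFun.cLaplacian (IsTestFun.cLaplacian
        ⟨hT, hTtest.2.1, closure_minimal hTK hKc.isClosed⟩)
    have hw : IsTestFun U (cpderiv i (cpderiv j (cpderiv l φ))) :=
      ((hφ.cpderiv l).cpderiv j).cpderiv i
    have hvi : ∀ {ψ : RH n → ℝ}, IsTestFun K ψ →
        Integrable (fun x => v x * ψ x) (volume.restrict K) := by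
      intro ψ hψ
      obtain ⟨C, hC⟩ := hψ.1.continuous.bounded_above_of_compact_support hψ.2.1
      exact hvK.mul_bdd (c := C) hψ.1.continuous.aestronglyMeasurable (Eventually.of_forall hC)
    have hpint := integral_mul_integral_comp_sub_mul hM hMi (ν := μp.restrict K) (a := fun _ => 1)
      (integrable_const 1) hφ.1.continuous hφ.2.1
    have hnint := integral_mul_integral_comp_sub_mul hM hMi (ν := μn.restrict K) (a := fun _ => 1)
      (integrable_const 1) hφ.1.continuous hφ.2.1
    have hvint := integral_mul_integral_comp_sub_mul hN.stronglyMeasurable hNi hvK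
      hφ.1.continuous hφ.2.1
    simp only [one_mul, ← hTM] at hpint hnint
    have hS : ∫ x in K, v x * ∫ y, N (x - y) * φ y
        = c * (∫ x in K, v x * cpderiv i (cpderiv j (cpderiv l φ)) x)
          - ∫ x in K, v x * cLaplacian (cLaplacian T) x := by
      rw [← integral_const_mul, ← integral_sub ((hvi (hw.mono hUK)).const_mul c) (hvi hT2)]
      congr 1 with x
      rw [hTN]
      ring
    have hrepT := hrep T hTtest
    rw [(hT2.mono hεΩ).setIntegral_mul_eq, hTint, hTint] at hrepT
    have hhess := hv.setIntegral_mul_cpderiv i j l hφΩ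
    rw [(hφΩ.cpderiv l).setIntegral_mul_eq, (hw.mono (hUK.trans hεΩ)).setIntegral_mul_eq] at hhess
    rw [(hw.mono hUK).setIntegral_mul_eq, hT2.setIntegral_mul_eq, hrepT, hhess, hvint.2, hpint.2,
      hnint.2] at hS
    have hsub : Integrable fun y =>
        (∫ x in K, M (x - y) ∂μp) * φ y - (∫ x in K, M (x - y) ∂μn) * φ y := hpint.1.sub hnint.1
    rw [(hφ.cpderiv l).setIntegral_mul_eq, hφ.setIntegral_mul_eq]
    simp only [mul_assoc, add_mul, sub_mul]
    rw [integral_const_mul, integral_add hsub hvint.1,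
      integral_sub hpint.1 hnint.1, hS]
    field_simp
    ring
  · exact ((((memLp_integral_comp_sub hM hq1 (hMq q hq1 hq) _).restrict U).sub
      ((memLp_integral_comp_sub hM hq1 (hMq q hq1 hq) _).restrict U)).add
      (memLp_integral_mul_comp_sub hN hNc hvK hUfin _)).const_mul _

/-- if `v ∈ H²(Ω)` satisfies `∫ Δv Δφ = ∫ φ dμ` for all test
functions, where `μ = μ⁺ - μ⁻` is a signed Radon measure on the smooth domain `Ω`,
then `v ∈ W^{3,q}_loc(Ω)` for every `q ∈ (1, n/(n-1))`. -/
theorem statement16 (n : ℕ) (hn : 0 < n) (Ω : Set (RH n)) (hΩ : IsSmoothDomain Ω)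
    (v lapv : RH n → ℝ) (hv : MemH2 Ω v) (hlapv : IsWeakLaplacian Ω v lapv)
    (μp μn : Measure (RH n))
    (hμp : ∀ K : Set (RH n), K ⊆ Ω → IsCompact K → μp K < ⊤)
    (hμn : ∀ K : Set (RH n), K ⊆ Ω → IsCompact K → μn K < ⊤)
    (hrep : ∀ φ : RH n → ℝ, IsTestFun Ω φ →
      ∫ x in Ω, lapv x * cLaplacian φ x
        = (∫ x in Ω, φ x ∂μp) - ∫ x in Ω, φ x ∂μn) :
    ∀ q : ℝ, 1 < q → q < (n : ℝ) / ((n : ℝ) - 1) →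
      MemW3qLoc Ω (ENNReal.ofReal q) v := by
  intro q hq1 hq U _ hUc hUΩ
  have hn2 : 2 ≤ n := by
    by_contra hn2
    obtain rfl : n = 1 := by omega
    norm_num at hq
    linarith
  have hq2 : q ≤ 2 := by
    have hn' : (2 : ℝ) ≤ n := by exact_mod_cast hn2
    refine hq.le.trans ?_
    rw [div_le_iff₀ (by linarith)]
    linarith
  obtain ⟨g, h, hvgh⟩ := hv
  have hU : U ⊆ Ω := subset_closure.trans hUΩ
  have hUfin : volume U ≠ ⊤ := ((measure_mono subset_closure).trans_lt hUc.measure_lt_top).ne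
  have hbi : ∀ φ : RH n → ℝ, IsTestFun Ω φ → ∫ x in Ω, v x * cLaplacian (cLaplacian φ) x
      = (∫ x in Ω, φ x ∂μp) - ∫ x in Ω, φ x ∂μn := fun φ hφ =>
    (hlapv _ hφ.cLaplacian).trans (hrep φ hφ)
  choose k hk using exists_isWeakPartial_hessian hn2 hΩ.1 hvgh hμp hμn hbi hUc hUΩ hq1.le hq
  exact ⟨memLp_of_memLp_two hvgh.1 hU hUfin hq2, g,
    fun i => ⟨(hvgh.2.1 i).1.mono hU, memLp_of_memLp_two (hvgh.2.1 i).2 hU hUfin hq2⟩, h,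
    fun i j => ⟨(hvgh.2.2 i j).1.mono hU, memLp_of_memLp_two (hvgh.2.2 i j).2 hU hUfin hq2⟩, k, hk⟩

end
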